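/- arXiv:2210.17096 — 6 statements merged into one kernel-verified Lean document; each statement's English description precedes it below -/
import Mathlib

section
/- Let C be a ring equipped with a ℤ/2-grading, i.e. additive subgroups C₀ and C₁ with C = C₀ ⊕ C₁ as an additive group and Cᵢ·Cⱼ ⊆ C_{i+j} (indices mod 2), which is supercommutative: x·y = (−1)^{i·j}·y·x for all x ∈ Cᵢ, y ∈ Cⱼ. Then C is metabelian: for all a, b, c ∈ C (not necessarily homogeneous), [a, [b, c]] = 0, where [x, y] := x·y − y·x. -/
/-- A supercommutative superring is metabelian: `[a,[b,c]] = 0` for all (not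
necessarily homogeneous) elements. Here the superring structure on the ring `C`
is given by additive subgroups `C₀`, `C₁` with `C = C₀ ⊕ C₁`, multiplicative
closure `Cᵢ·Cⱼ ⊆ C_{i+j}` (mod 2), and supercommutativity
`x·y = (−1)^{ij}·y·x` on homogeneous elements. -/
theorem supercommutative_is_metabelian {C : Type*} [Ring C]
    (C₀ C₁ : AddSubgroup C)
    (hdecomp : ∀ x : C, ∃ x₀ ∈ C₀, ∃ x₁ ∈ C₁, x = x₀ + x₁)
    (hdisj : ∀ x : C, x ∈ C₀ → x ∈ C₁ → x = 0)
    (hmul00 : ∀ x ∈ C₀, ∀ y ∈ C₀, x * y ∈ C₀)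
    (hmul01 : ∀ x ∈ C₀, ∀ y ∈ C₁, x * y ∈ C₁)
    (hmul10 : ∀ x ∈ C₁, ∀ y ∈ C₀, x * y ∈ C₁)
    (hmul11 : ∀ x ∈ C₁, ∀ y ∈ C₁, x * y ∈ C₀)
    (hcomm00 : ∀ x ∈ C₀, ∀ y ∈ C₀, x * y = y * x)
    (hcomm01 : ∀ x ∈ C₀, ∀ y ∈ C₁, x * y = y * x)
    (hcomm10 : ∀ x ∈ C₁, ∀ y ∈ C₀, x * y = y * x)
    (hcomm11 : ∀ x ∈ C₁, ∀ y ∈ C₁, x * y = -(y * x)) :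
    ∀ a b c : C, a * (b * c - c * b) - (b * c - c * b) * a = 0 := by
  intro a b c
  obtain ⟨a₀, ha₀, a₁, ha₁, rfl⟩ := hdecomp a
  obtain ⟨b₀, hb₀, b₁, hb₁, rfl⟩ := hdecomp b
  obtain ⟨c₀, hc₀, c₁, hc₁, rfl⟩ := hdecomp c
  have hbc : (b₀ + b₁) * (c₀ + c₁) - (c₀ + c₁) * (b₀ + b₁) = b₁ * c₁ - c₁ * b₁ := by
    simp only [add_mul, mul_add]
    rw [hcomm00 b₀ hb₀ c₀ hc₀, hcomm01 b₀ hb₀ c₁ hc₁, hcomm10 b₁ hb₁ c₀ hc₀]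
    abel
  have hmem : b₁ * c₁ - c₁ * b₁ ∈ C₀ :=
    C₀.sub_mem (hmul11 b₁ hb₁ c₁ hc₁) (hmul11 c₁ hc₁ b₁ hb₁)
  rw [hbc, add_mul, mul_add, hcomm00 a₀ ha₀ _ hmem, hcomm10 a₁ ha₁ _ hmem, sub_self]
end

section
/- Let R be a commutative ring and M an R-module. Then the exterior algebra Λ(M) over R is metabelian: for all a, b, c ∈ Λ(M), a·(b·c − c·b) = (b·c − c·b)·a, i.e. [a, [b, c]] = 0, where [x, y] := x·y − y·x is the ordinary ring commutator. -/
namespace ExteriorAlgebra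

variable {R : Type*} [CommRing R] {M : Type*} [AddCommGroup M] [Module R M]

/-- An element commuting with all generators of the exterior algebra is central. -/
theorem commute_of_forall_commute_ι {e : ExteriorAlgebra R M}
    (he : ∀ m, Commute (ι R m) e) (x : ExteriorAlgebra R M) : Commute x e := by
  induction x using ExteriorAlgebra.induction with
  | algebraMap r => exact Algebra.commutes r e
  | ι m => exact he m
  | mul x y hx hy => exact hx.mul_left hy
  | add x y hx hy => exact hx.add_left hy

/-- The product of two elements anticommuting with all generators is central. -/
theorem commute_mul_of_anticommute_ι {o o' : ExteriorAlgebra R M}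
    (ho : ∀ m, ι R m * o = -(o * ι R m)) (ho' : ∀ m, ι R m * o' = -(o' * ι R m))
    (x : ExteriorAlgebra R M) : Commute x (o * o') := by
  refine commute_of_forall_commute_ι (fun m => ?_) x
  change _ * _ = _ * _
  rw [← mul_assoc, ho, neg_mul, mul_assoc, ho', mul_neg, neg_neg, mul_assoc]

/-- Every element of the exterior algebra is the sum of an element commuting with all generators
and an element anticommuting with all generators. -/
theorem exists_eq_add_commute_anticommute (x : ExteriorAlgebra R M) :
    ∃ e o : ExteriorAlgebra R M, x = e + o ∧ (∀ m, Commute (ι R m) e) ∧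
      ∀ m, ι R m * o = -(o * ι R m) := by
  induction x using ExteriorAlgebra.induction with
  | algebraMap r =>
    exact ⟨algebraMap R _ r, 0, by simp, fun m => (Algebra.commutes r _).symm, by simp⟩
  | ι m =>
    exact ⟨0, ι R m, by simp, fun n => Commute.zero_right _,
      fun n => eq_neg_of_add_eq_zero_left (ι_add_mul_swap n m)⟩
  | mul x y hx hy =>
    obtain ⟨e, o, rfl, he, ho⟩ := hx
    obtain ⟨e', o', rfl, he', ho'⟩ := hy
    refine ⟨e * e' + o * o', e * o' + o * e', by noncomm_ring, fun m => ?_, fun m => ?_⟩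
    · exact ((he m).mul_right (he' m)).add_right (commute_mul_of_anticommute_ι ho ho' _)
    · rw [mul_add, ← mul_assoc, (he m).eq, mul_assoc, ho', ← mul_assoc, ho, neg_mul,
        mul_assoc o, (he' m).eq]
      noncomm_ring
  | add x y hx hy =>
    obtain ⟨e, o, rfl, he, ho⟩ := hx
    obtain ⟨e', o', rfl, he', ho'⟩ := hy
    refine ⟨e + e', o + o', by abel, fun m => (he m).add_right (he' m), fun m => ?_⟩
    rw [mul_add, ho, ho', add_mul, neg_add]

end ExteriorAlgebra

/-- The exterior algebra `Λ(M)` over a commutative ring `R` is metabelian: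
`[a,[b,c]] = 0` for all `a b c`, where `[x,y] := x·y − y·x` is the ordinary
ring commutator. -/
theorem exteriorAlgebra_metabelian {R : Type*} [CommRing R]
    {M : Type*} [AddCommGroup M] [Module R M]
    (a b c : ExteriorAlgebra R M) :
    a * (b * c - c * b) - (b * c - c * b) * a = 0 := by
  obtain ⟨e, o, rfl, he, ho⟩ := ExteriorAlgebra.exists_eq_add_commute_anticommute b
  obtain ⟨e', o', rfl, he', ho'⟩ := ExteriorAlgebra.exists_eq_add_commute_anticommute c
  have key : (e + o) * (e' + o') - (e' + o') * (e + o) = o * o' - o' * o := by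
    rw [add_mul e o, add_mul e' o', mul_add o, mul_add o',
      ← (ExteriorAlgebra.commute_of_forall_commute_ι he (e' + o')).eq,
      (ExteriorAlgebra.commute_of_forall_commute_ι he' o).eq,
      mul_add e', add_mul e' o']
    abel
  rw [key, sub_eq_zero]
  exact (ExteriorAlgebra.commute_mul_of_anticommute_ι ho ho' a).sub_right
    (ExteriorAlgebra.commute_mul_of_anticommute_ι ho' ho a)
end

section
/- Let C be a supercommutative superring in which 2 is invertible, and let p be a completely prime two-sided ideal of C. Then S := C ∖ p is a multiplicative set containing 1 and satisfies both the left Ore condition (for every a ∈ C and s ∈ S there exist b ∈ C and t ∈ S with t·a = b·s) and the right Ore condition (for every a ∈ C and s ∈ S there exist b ∈ C and t ∈ S with a·t = s·b). -/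
/-- Let `C` be a supercommutative superring in which `2` is invertible and let
`p` be a completely prime two-sided ideal. Then `S := C ∖ p` is a
multiplicative set containing `1` which satisfies both the left and the right
Ore conditions. -/
theorem complement_of_completelyPrime_is_Ore {C : Type*} [Ring C]
    (C₀ C₁ : AddSubgroup C)
    (hdecomp : ∀ x : C, ∃ x₀ ∈ C₀, ∃ x₁ ∈ C₁, x = x₀ + x₁)
    (hdisj : ∀ x : C, x ∈ C₀ → x ∈ C₁ → x = 0)
    (hmul00 : ∀ x ∈ C₀, ∀ y ∈ C₀, x * y ∈ C₀)
    (hmul01 : ∀ x ∈ C₀, ∀ y ∈ C₁, x * y ∈ C₁)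
    (hmul10 : ∀ x ∈ C₁, ∀ y ∈ C₀, x * y ∈ C₁)
    (hmul11 : ∀ x ∈ C₁, ∀ y ∈ C₁, x * y ∈ C₀)
    (hcomm00 : ∀ x ∈ C₀, ∀ y ∈ C₀, x * y = y * x)
    (hcomm01 : ∀ x ∈ C₀, ∀ y ∈ C₁, x * y = y * x)
    (hcomm10 : ∀ x ∈ C₁, ∀ y ∈ C₀, x * y = y * x)
    (hcomm11 : ∀ x ∈ C₁, ∀ y ∈ C₁, x * y = -(y * x))
    (h2 : IsUnit (2 : C))
    (p : TwoSidedIdeal C) (hproper : p ≠ ⊤)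
    (hprime : ∀ a b : C, a * b ∈ p → a ∈ p ∨ b ∈ p) :
    (1 : C) ∉ p ∧
    (∀ s t : C, s ∉ p → t ∉ p → s * t ∉ p) ∧
    (∀ a s : C, s ∉ p → ∃ b t : C, t ∉ p ∧ t * a = b * s) ∧
    (∀ a s : C, s ∉ p → ∃ b t : C, t ∉ p ∧ a * t = s * b) := by
  have hcentral : ∀ x ∈ C₀, ∀ y : C, x * y = y * x := by
    intro x hx y
    obtain ⟨y₀, hy₀, y₁, hy₁, rfl⟩ := hdecomp y
    rw [mul_add, add_mul, hcomm00 x hx y₀ hy₀, hcomm01 x hx y₁ hy₁]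
  have hsq : ∀ x ∈ C₁, x * x = 0 := by
    intro x hx
    have h : (2 : C) * (x * x) = 0 := by
      rw [two_mul]
      exact eq_neg_iff_add_eq_zero.mp (hcomm11 x hx x hx)
    exact h2.mul_right_eq_zero.mp h
  have hodd : ∀ x ∈ C₁, x ∈ p := fun x hx =>
    (hprime x x (by rw [hsq x hx]; exact p.zero_mem)).elim id id
  have hmul : ∀ s t : C, s ∉ p → t ∉ p → s * t ∉ p := fun s t hs ht h =>
    (hprime s t h).elim hs ht
  have hdenom : ∀ s : C, s ∉ p →
      ∃ t u : C, t ∉ p ∧ (∀ a : C, t * a = a * t) ∧ u * s = t ∧ s * u = t := by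
    intro s hs
    obtain ⟨s₀, hs₀, s₁, hs₁, rfl⟩ := hdecomp s
    have hs₀p : s₀ ∉ p := fun h => hs (p.add_mem h (hodd s₁ hs₁))
    have hc := hcomm01 s₀ hs₀ s₁ hs₁
    have hz := hsq s₁ hs₁
    refine ⟨s₀ * s₀, s₀ - s₁, hmul _ _ hs₀p hs₀p,
      hcentral _ (hmul00 s₀ hs₀ s₀ hs₀), ?_, ?_⟩
    · rw [sub_mul, mul_add, mul_add, hz, hc]
      abel
    · rw [add_mul, mul_sub, mul_sub, hz, hc]
      abel
  refine ⟨fun h => hproper (p.one_mem_iff.mp h), hmul, ?_, ?_⟩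
  · intro a s hs
    obtain ⟨t, u, ht, hcomm, hus, -⟩ := hdenom s hs
    exact ⟨a * u, t, ht, by rw [hcomm, mul_assoc, hus]⟩
  · intro a s hs
    obtain ⟨t, u, ht, hcomm, -, hsu⟩ := hdenom s hs
    exact ⟨u * a, t, ht, by rw [← hcomm, ← mul_assoc, hsu]⟩
end

section
/- Let K be a field of characteristic 0 and n ≥ 1. Let f be a K-linear functional on the subspace Q_n ⊆ Mat_{2n}(K) of all block matrices fromBlocks A B B A such that f vanishes on all supercommutators of homogeneous elements of Q_n (i.e. f(XY − YX) = 0 when X, Y ∈ Q_n are homogeneous with at least one even, and f(XY + YX) = 0 when both are odd). Then there exists c ∈ K with f(fromBlocks A B B A) = c·tr(B) for all A, B; i.e. the queertrace is the unique, up to a scalar, trace on q(n). -/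
open Matrix

/-- A linear functional on a full matrix algebra which vanishes on commutators is a scalar
multiple of the trace. -/
theorem Matrix.exists_eq_mul_trace {ι R : Type*} [Fintype ι] [DecidableEq ι] [CommRing R]
    (g : Matrix ι ι R →ₗ[R] R) (hg : ∀ A B, g (A * B) = g (B * A)) :
    ∃ c : R, ∀ A, g A = c * A.trace := by
  cases isEmpty_or_nonempty ι with
  | inl _ => exact ⟨0, fun A => by rw [Subsingleton.elim A 0, map_zero, zero_mul]⟩
  | inr h =>
    obtain ⟨k⟩ := h
    refine ⟨g (single k k 1), fun A => ?_⟩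
    suffices g = g (single k k 1) • traceLinearMap ι R R by
      simpa using LinearMap.congr_fun this A
    refine ext_linearMap R fun i j => LinearMap.ext_ring ?_
    have h := hg (single i k 1) (single k j 1)
    rcases eq_or_ne i j with rfl | hij
    · simpa using h
    · simpa [hij, hij.symm] using h

/-- Over a field of characteristic `0`, any linear functional on the queer Lie
superalgebra `q(n)` (realized as the subspace of `Mat_{2n}(K)` of block
matrices `fromBlocks A B B A`) vanishing on all supercommutators of its
homogeneous elements is a scalar multiple of the queertrace
`qtr (A, B) = tr B`: the queertrace is the unique, up to a scalar, trace on
`q(n)`. -/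
theorem queerTrace_unique {K : Type*} [Field K] [CharZero K] {n : ℕ}
    (hn : 1 ≤ n)
    (f : Matrix (Fin n ⊕ Fin n) (Fin n ⊕ Fin n) K →ₗ[K] K)
    (heven : ∀ A A' : Matrix (Fin n) (Fin n) K,
      f (fromBlocks A 0 0 A * fromBlocks A' 0 0 A'
        - fromBlocks A' 0 0 A' * fromBlocks A 0 0 A) = 0)
    (hevenodd : ∀ A B' : Matrix (Fin n) (Fin n) K,
      f (fromBlocks A 0 0 A * fromBlocks 0 B' B' 0
        - fromBlocks 0 B' B' 0 * fromBlocks A 0 0 A) = 0)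
    (hoddeven : ∀ A B : Matrix (Fin n) (Fin n) K,
      f (fromBlocks 0 B B 0 * fromBlocks A 0 0 A
        - fromBlocks A 0 0 A * fromBlocks 0 B B 0) = 0)
    (hodd : ∀ B B' : Matrix (Fin n) (Fin n) K,
      f (fromBlocks 0 B B 0 * fromBlocks 0 B' B' 0
        + fromBlocks 0 B' B' 0 * fromBlocks 0 B B 0) = 0) :
    ∃ c : K, ∀ A B : Matrix (Fin n) (Fin n) K,
      f (fromBlocks A B B A) = c * Matrix.trace B := by
  have hf_even (A : Matrix (Fin n) (Fin n) K) : f (fromBlocks A 0 0 A) = 0 := by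
    simpa [fromBlocks_multiply] using hodd A 1
  let g : Matrix (Fin n) (Fin n) K →ₗ[K] K :=
    { toFun := fun B => f (fromBlocks 0 B B 0)
      map_add' := fun B B' => by simp [← map_add, fromBlocks_add]
      map_smul' := fun c B => by
        simpa [fromBlocks_smul] using map_smul f c (fromBlocks 0 B B 0) }
  have hg (A B : Matrix (Fin n) (Fin n) K) : g (A * B) = g (B * A) := by
    simpa [g, fromBlocks_multiply, sub_eq_zero] using hevenodd A B
  obtain ⟨c, hc⟩ := exists_eq_mul_trace g hg
  refine ⟨c, fun A B => ?_⟩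
  calc f (fromBlocks A B B A) = f (fromBlocks A 0 0 A) + f (fromBlocks 0 B B 0) := by
        simp [← map_add, fromBlocks_add]
    _ = c * B.trace := by rw [hf_even, zero_add, ← hc]; rfl
end

section
/- Let V be a d-dimensional complex vector space, Λ = Λ(V) its exterior algebra with parity decomposition Λ = Λ₀ ⊕ Λ₁, and n ≥ 1. For an invertible n×n matrix A with entries in Λ₀ and an n×n matrix B with entries in Λ₁, set q(A, B) := Σ_{i=1}^{d} tr((A⁻¹B)^{2i−1})/(2i−1) (a finite sum, since (A⁻¹B)^k = 0 for k > d). If A and A' are invertible with entries in Λ₀ and B, B' have entries in Λ₁, then AA' + BB' is invertible with entries in Λ₀, and q(AA' + BB', AB' + BA') = q(A, B) + q(A', B'). Equivalently, the queer determinant qet(A, B) := 1 + τ·q(A, B), with τ odd and τ² = 0, is a group homomorphism GQ(n; Λ) → GL(1; Λ[τ]). -/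
open Matrix Finset

/-- The even part `Λ₀` of the exterior algebra. -/
noncomputable def exteriorEvenPart (V : Type*) [AddCommGroup V] [Module ℂ V] :
    Submodule ℂ (ExteriorAlgebra ℂ V) :=
  ⨆ j : ℕ, ⋀[ℂ]^(2 * j) V

/-- The odd part `Λ₁` of the exterior algebra. -/
noncomputable def exteriorOddPart (V : Type*) [AddCommGroup V] [Module ℂ V] :
    Submodule ℂ (ExteriorAlgebra ℂ V) :=
  ⨆ j : ℕ, ⋀[ℂ]^(2 * j + 1) V

/-- The quantity `q(A,B) = Σ_{i=1}^{d} tr((A⁻¹B)^{2i−1})/(2i−1)`, expressed in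
terms of `M = A⁻¹·B`; `qet(A,B) = 1 + τ·q(A,B)` is the queer determinant. -/
noncomputable def queerDetExponent {V : Type*} [AddCommGroup V] [Module ℂ V]
    (d : ℕ) {n : ℕ} (M : Matrix (Fin n) (Fin n) (ExteriorAlgebra ℂ V)) :
    ExteriorAlgebra ℂ V :=
  ∑ i ∈ Finset.range d, (((2 * i + 1 : ℕ) : ℂ))⁻¹ • Matrix.trace (M ^ (2 * i + 1))

/-- The logarithm series `log (1 + x)`, truncated after `m` terms. -/
noncomputable def truncLog {R : Type*} [Ring R] [Algebra ℂ R] (m : ℕ) (x : R) : R :=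
  ∑ k ∈ range m, (((k + 1 : ℕ) : ℂ)⁻¹ * (-1) ^ k) • x ^ (k + 1)

section TruncLog

open Polynomial

variable {R : Type*} [Ring R] [Algebra ℂ R]

theorem map_truncLog {T : Type*} [Ring T] [Algebra ℂ T] (f : R →ₐ[ℂ] T) (m : ℕ) (x : R) :
    f (truncLog m x) = truncLog m (f x) := by
  simp [truncLog]

theorem truncLog_zero (m : ℕ) : truncLog m (0 : R) = 0 := by
  simp [truncLog]

/-- The polynomials all of whose coefficients lie in `K`. -/
def coeffSubmodule (K : Submodule ℂ R) : Submodule ℂ R[X] where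
  carrier := {p | ∀ n, p.coeff n ∈ K}
  add_mem' hp hq n := by simpa using K.add_mem (hp n) (hq n)
  zero_mem' n := by simp
  smul_mem' c p hp n := by simpa using K.smul_mem c (hp n)

theorem commutator_mem_coeffSubmodule {K : Submodule ℂ R}
    (hK : ∀ x y : R, x * y - y * x ∈ K) (p q : R[X]) :
    p * q - q * p ∈ coeffSubmodule K := by
  intro n
  rw [coeff_sub, coeff_mul, coeff_mul, ← Finset.Nat.sum_antidiagonal_swap, ← Finset.sum_sub_distrib]
  exact K.sum_mem fun i _ => by simpa using hK _ _

theorem coeffSubmodule_mul_le (S T : Submodule ℂ R) :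
    coeffSubmodule S * coeffSubmodule T ≤ coeffSubmodule (S * T) := by
  rw [Submodule.mul_le]
  intro p hp q hq n
  rw [coeff_mul]
  exact Submodule.sum_mem _ fun i _ => Submodule.mul_mem_mul (hp _) (hq _)

theorem pow_mem_coeffSubmodule {S : Submodule ℂ R} {p : R[X]} (hp : p ∈ coeffSubmodule S)
    (m : ℕ) : p ^ m ∈ coeffSubmodule (S ^ m) := by
  induction m with
  | zero =>
    intro n
    rw [pow_zero, pow_zero, coeff_one]
    split_ifs
    · exact Submodule.one_le.mp le_rfl
    · exact Submodule.zero_mem _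
  | succ m ih =>
    rw [pow_succ, pow_succ]
    exact coeffSubmodule_mul_le _ _ (Submodule.mul_mem_mul ih hp)

theorem derivative_pow_mul_pow_mem {K : Submodule ℂ R}
    (hK : ∀ x y : R, x * y - y * x ∈ K) (u : R[X]) (k j : ℕ) :
    derivative (u ^ (k + 1)) * u ^ j - ((k + 1 : ℕ) : ℂ) • (u ^ (k + j) * derivative u)
      ∈ coeffSubmodule K := by
  induction k generalizing j with
  | zero => simpa using commutator_mem_coeffSubmodule hK (derivative u) (u ^ j)
  | succ k ih =>
    have h := add_mem (ih (j + 1))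
      (commutator_mem_coeffSubmodule hK (u ^ (k + 1) * derivative u) (u ^ j))
    convert h using 1
    rw [pow_succ u (k + 1), derivative_mul, show k + 1 + j = j + (k + 1) by ring,
      show k + (j + 1) = j + (k + 1) by ring, pow_add u j (k + 1), pow_succ' u j]
    push_cast
    simp only [add_smul, one_smul]
    noncomm_ring

theorem derivative_truncLog_mem {K : Submodule ℂ R}
    (hK : ∀ x y : R, x * y - y * x ∈ K) (m : ℕ) (u : R[X]) :
    derivative (truncLog m u) - (∑ k ∈ range m, (-u) ^ k) * derivative u
      ∈ coeffSubmodule K := by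
  rw [truncLog, derivative_sum, Finset.sum_mul, ← Finset.sum_sub_distrib]
  refine Submodule.sum_mem _ fun k _ => ?_
  have h := Submodule.smul_mem _ (((k + 1 : ℕ) : ℂ)⁻¹ * (-1) ^ k)
    (derivative_pow_mul_pow_mem hK u k 0)
  convert h using 1
  have hk : ((k + 1 : ℕ) : ℂ) ≠ 0 := Nat.cast_ne_zero.mpr k.succ_ne_zero
  rw [pow_zero, mul_one, add_zero, derivative_smul, smul_sub, smul_smul, mul_right_comm,
    inv_mul_cancel₀ hk, one_mul, ← smul_mul_assoc, neg_pow u k]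
  congr 2
  rw [Algebra.smul_def]
  simp

theorem geom_sum_neg_mul_one_add {T : Type*} [Ring T] {u : T} {m : ℕ} (hu : u ^ m = 0) :
    (∑ k ∈ range m, (-u) ^ k) * (1 + u) = 1 := by
  have h := geom_sum_mul_neg (-u) m
  rwa [sub_neg_eq_add, neg_pow, hu, mul_zero, sub_zero] at h

theorem one_add_mul_geom_sum_neg {T : Type*} [Ring T] {u : T} {m : ℕ} (hu : u ^ m = 0) :
    (1 + u) * (∑ k ∈ range m, (-u) ^ k) = 1 := by
  have h := mul_neg_geom_sum (-u) m
  rwa [sub_neg_eq_add, neg_pow, hu, mul_zero, sub_zero] at h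

theorem eval_one_sub_eval_zero_mem {K : Submodule ℂ R} {p : R[X]}
    (hp : derivative p ∈ coeffSubmodule K) : p.eval 1 - p.eval 0 ∈ K := by
  have h (n : ℕ) : p.coeff (n + 1) ∈ K := by
    have h1 := K.smul_mem ((n + 1 : ℕ) : ℂ)⁻¹ (hp n)
    have hn : ((n + 1 : ℕ) : ℂ) ≠ 0 := Nat.cast_ne_zero.mpr n.succ_ne_zero
    have h2 : p.coeff (n + 1) * ((n : R) + 1) = ((n + 1 : ℕ) : ℂ) • p.coeff (n + 1) := by
      rw [Nat.cast_smul_eq_nsmul, nsmul_eq_mul, ← Nat.cast_succ, Nat.cast_comm]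
    rwa [coeff_derivative, h2, inv_smul_smul₀ hn] at h1
  rw [eval_eq_sum_range, Finset.sum_range_succ', ← coeff_zero_eq_eval_zero]
  simpa using K.sum_mem fun n _ => h n

/-- Evaluation of polynomials at a central element as an algebra homomorphism. -/
noncomputable def evalCentral (a : R) (ha : ∀ b, Commute b a) : R[X] →ₐ[ℂ] R :=
  AlgHom.mk' (eval₂RingHom' (RingHom.id R) a ha) fun c p => eval_smul c p a

theorem truncLog_mul_mem {K S : Submodule ℂ R}
    (hK : ∀ x y : R, x * y - y * x ∈ K) (hS : S * S ≤ S) {m : ℕ} (hm : S ^ m = ⊥)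
    {x y : R} (hx : x ∈ S) (hy : y ∈ S) :
    truncLog m (x + y + x * y) - (truncLog m x + truncLog m y) ∈ K := by
  have nilp {p : R[X]} (hp : p ∈ coeffSubmodule S) : p ^ m = 0 := by
    ext n
    simpa [hm] using pow_mem_coeffSubmodule hp m n
  have hC {a : R} (ha : a ∈ S) : C a ∈ coeffSubmodule S := fun n => by
    rw [coeff_C]; split_ifs <;> simp [ha]
  have hXC {a : R} (ha : a ∈ S) : C a * X ∈ coeffSubmodule S := fun n => by
    rw [coeff_C_mul_X]; split_ifs <;> simp [ha]
  have hxy : x * y ∈ S := hS (Submodule.mul_mem_mul hx hy)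
  set v : R[X] := C x * X with hv
  set u : R[X] := v + C y + C (x * y) * X with hu
  have hvm := nilp (hXC hx)
  have hum : u ^ m = 0 := nilp (add_mem (add_mem (hXC hx) (hC hy)) (hXC hxy))
  have huv : 1 + u = (1 + v) * (1 + C y) := by
    rw [hu, hv, C_mul, mul_assoc (C x) (C y), ← X_mul_C y]
    noncomm_ring
  have hdv : derivative v = C x := by simp [hv]
  have hdu : derivative u = C x * (1 + C y) := by simp [hu, hv, mul_add]
  set gu := ∑ k ∈ range m, (-u) ^ k with hgu
  set gv := ∑ k ∈ range m, (-v) ^ k with hgv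
  have hg : (1 + C y) * gu = gv := by
    have h1 : gv * (1 + v) = 1 := geom_sum_neg_mul_one_add hvm
    have h2 : (1 + v) * ((1 + C y) * gu) = 1 := by
      rw [← mul_assoc, ← huv]; exact one_add_mul_geom_sum_neg hum
    exact (left_inv_eq_right_inv h1 h2).symm
  have hD : derivative (truncLog m u - truncLog m v) ∈ coeffSubmodule K := by
    have h := add_mem (sub_mem (derivative_truncLog_mem hK m u) (derivative_truncLog_mem hK m v))
      (commutator_mem_coeffSubmodule hK (gu * C x) (1 + C y))
    convert h using 1
    rw [← hgu, ← hgv, ← hg, hdv, hdu, derivative_sub]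
    noncomm_ring
  have key := eval_one_sub_eval_zero_mem hD
  have e1 (p : R[X]) : (truncLog m p).eval 1 = truncLog m (p.eval 1) :=
    map_truncLog (evalCentral 1 Commute.one_right) m p
  have e0 (p : R[X]) : (truncLog m p).eval 0 = truncLog m (p.eval 0) :=
    map_truncLog (evalCentral 0 Commute.zero_right) m p
  rw [eval_sub, eval_sub, e1, e1, e0, e0] at key
  have u1 : u.eval 1 = x + y + x * y := by simp [hu, hv]
  have u0 : u.eval 0 = y := by simp [hu, hv]
  have v1 : v.eval 1 = x := by simp [hv]
  have v0 : v.eval 0 = 0 := by simp [hv]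
  rw [u1, u0, v1, v0, truncLog_zero] at key
  convert key using 1
  abel

theorem truncLog_conj_sub_mem {K : Submodule ℂ R} (hK : ∀ x y : R, x * y - y * x ∈ K)
    (m : ℕ) {a b : R} (hab : a * b = 1) (x : R) :
    truncLog m (b * x * a) - truncLog m x ∈ K := by
  have hpow (k : ℕ) : (b * x * a) ^ (k + 1) = b * x ^ (k + 1) * a := by
    induction k with
    | zero => simp
    | succ k ih =>
      rw [pow_succ, ih, pow_succ x (k + 1)]
      simp only [mul_assoc]
      rw [← mul_assoc a b, hab, one_mul]
  have h : truncLog m (b * x * a) = b * (truncLog m x * a) := by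
    simp only [truncLog, hpow]
    simp only [Finset.mul_sum, Finset.sum_mul, mul_assoc, smul_mul_assoc,
      mul_smul_comm]
  have := hK b (truncLog m x * a)
  rwa [mul_assoc, hab, mul_one, ← h] at this

end TruncLog

section Parity

open CliffordAlgebra

variable {V : Type*} [AddCommGroup V] [Module ℂ V]

theorem exteriorEvenPart_eq_evenOdd :
    exteriorEvenPart V = evenOdd (0 : QuadraticForm ℂ V) 0 := by
  refine le_antisymm (iSup_le fun j => ?_) (iSup_le ?_)
  · exact le_iSup_of_le (ι := { n : ℕ // (n : ZMod 2) = 0 })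
      ⟨2 * j, (ZMod.natCast_eq_zero_iff _ _).mpr (dvd_mul_right 2 j)⟩ le_rfl
  · rintro ⟨k, hk⟩
    obtain ⟨j, rfl⟩ := (ZMod.natCast_eq_zero_iff _ _).mp hk
    exact le_iSup_of_le j le_rfl

theorem exteriorOddPart_eq_evenOdd :
    exteriorOddPart V = evenOdd (0 : QuadraticForm ℂ V) 1 := by
  refine le_antisymm (iSup_le fun j => ?_) (iSup_le ?_)
  · exact le_iSup_of_le (ι := { n : ℕ // (n : ZMod 2) = 1 })
      ⟨2 * j + 1, (ZMod.natCast_eq_one_iff_odd).mpr (odd_two_mul_add_one j)⟩ le_rfl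
  · rintro ⟨k, hk⟩
    obtain ⟨j, rfl⟩ := (ZMod.natCast_eq_one_iff_odd).mp hk
    exact le_iSup_of_le j le_rfl

theorem commute_of_mem_evenOdd_zero {x : ExteriorAlgebra ℂ V}
    (hx : x ∈ evenOdd (0 : QuadraticForm ℂ V) 0) (y : ExteriorAlgebra ℂ V) : Commute x y := by
  induction x, hx using CliffordAlgebra.even_induction with
  | algebraMap r => exact Algebra.commutes r y
  | add a b _ _ ha hb => exact ha.add_left hb
  | ι_mul_ι_mul a b z _ hz =>
    refine Commute.mul_left ?_ hz
    clear hz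
    induction y using ExteriorAlgebra.induction with
    | algebraMap r => exact (Algebra.commutes r _).symm
    | ι c =>
      have anti (v w : V) : ExteriorAlgebra.ι ℂ v * ExteriorAlgebra.ι ℂ w
          = -(ExteriorAlgebra.ι ℂ w * ExteriorAlgebra.ι ℂ v) :=
        eq_neg_of_add_eq_zero_left (ExteriorAlgebra.ι_add_mul_swap v w)
      change ExteriorAlgebra.ι ℂ a * ExteriorAlgebra.ι ℂ b * ExteriorAlgebra.ι ℂ c
        = ExteriorAlgebra.ι ℂ c * (ExteriorAlgebra.ι ℂ a * ExteriorAlgebra.ι ℂ b)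
      rw [mul_assoc, anti b c, mul_neg, ← mul_assoc, anti a c, neg_mul, neg_neg, mul_assoc]
    | mul p q hp hq => exact hp.mul_right hq
    | add p q hp hq => exact hp.add_right hq

theorem commutator_mem_evenOdd_zero (x y : ExteriorAlgebra ℂ V) :
    x * y - y * x ∈ evenOdd (0 : QuadraticForm ℂ V) 0 := by
  have top : evenOdd (0 : QuadraticForm ℂ V) 0 ⊔ evenOdd (0 : QuadraticForm ℂ V) 1 = ⊤ :=
    (evenOdd_isCompl (0 : QuadraticForm ℂ V)).sup_eq_top
  obtain ⟨x₀, hx₀, x₁, hx₁, rfl⟩ := Submodule.mem_sup.mp (top ▸ Submodule.mem_top (x := x))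
  obtain ⟨y₀, hy₀, y₁, hy₁, rfl⟩ := Submodule.mem_sup.mp (top ▸ Submodule.mem_top (x := y))
  have h : (x₀ + x₁) * (y₀ + y₁) - (y₀ + y₁) * (x₀ + x₁) = x₁ * y₁ - y₁ * x₁ := by
    simp only [add_mul, mul_add, (commute_of_mem_evenOdd_zero hx₀ y₀).eq,
      (commute_of_mem_evenOdd_zero hx₀ y₁).eq, (commute_of_mem_evenOdd_zero hy₀ x₁).eq]
    abel
  have odd_mul {a b : ExteriorAlgebra ℂ V} (ha : a ∈ evenOdd (0 : QuadraticForm ℂ V) 1)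
      (hb : b ∈ evenOdd (0 : QuadraticForm ℂ V) 1) :
      a * b ∈ evenOdd (0 : QuadraticForm ℂ V) 0 :=
    evenOdd_mul_le _ 1 1 (Submodule.mul_mem_mul ha hb)
  rw [h]
  exact sub_mem (odd_mul hx₁ hy₁) (odd_mul hy₁ hx₁)

/-- The augmentation ideal of the exterior algebra. -/
def exteriorPosPart (V : Type*) [AddCommGroup V] [Module ℂ V] :
    Submodule ℂ (ExteriorAlgebra ℂ V) :=
  ⨆ j : ℕ, ⋀[ℂ]^(j + 1) V

theorem evenOdd_one_le_exteriorPosPart :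
    evenOdd (0 : QuadraticForm ℂ V) 1 ≤ exteriorPosPart V := by
  rw [← exteriorOddPart_eq_evenOdd]
  exact iSup_le fun j => le_iSup_of_le (2 * j) le_rfl

theorem exteriorPosPart_mul_self_le :
    exteriorPosPart V * exteriorPosPart V ≤ exteriorPosPart V := by
  rw [exteriorPosPart, Submodule.iSup_mul]
  refine iSup_le fun i => ?_
  rw [Submodule.mul_iSup]
  refine iSup_le fun j => le_iSup_of_le (i + 1 + j) ?_
  rw [← pow_add, show i + 1 + (j + 1) = i + 1 + j + 1 by ring]

theorem exteriorPosPart_pow_le (k : ℕ) : exteriorPosPart V ^ k ≤ ⨆ j : ℕ, ⋀[ℂ]^(j + k) V := by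
  induction k with
  | zero => exact le_iSup_of_le 0 le_rfl
  | succ k ih =>
    rw [pow_succ]
    refine (mul_le_mul_left ih _).trans ?_
    rw [Submodule.iSup_mul]
    refine iSup_le fun i => ?_
    rw [exteriorPosPart, Submodule.mul_iSup]
    refine iSup_le fun j => le_iSup_of_le (i + j) ?_
    rw [← pow_add, show i + k + (j + 1) = i + j + (k + 1) by ring]

theorem exteriorPosPart_pow_eq_bot [FiniteDimensional ℂ V] {k : ℕ}
    (hk : Module.finrank ℂ V < k) : exteriorPosPart V ^ k = ⊥ := by
  refine le_bot_iff.mp ((exteriorPosPart_pow_le k).trans (iSup_le fun j => le_bot_iff.mpr ?_))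
  rw [← Submodule.finrank_eq_zero (R := ℂ), exteriorPower.finrank_eq]
  exact Nat.choose_eq_zero_of_lt (by omega)

end Parity

section MatrixParity

open CliffordAlgebra

theorem matrix_mul_matrix_le {R : Type*} [Ring R] [Algebra ℂ R] {ι : Type*} [Fintype ι]
    [DecidableEq ι] (S T : Submodule ℂ R) :
    (S.matrix : Submodule ℂ (Matrix ι ι R)) * T.matrix ≤ (S * T).matrix := by
  rw [Submodule.mul_le]
  intro M hM N hN i j
  exact Submodule.sum_mem _ fun k _ => Submodule.mul_mem_mul (hM i k) (hN k j)

theorem matrix_pow_eq_bot {R : Type*} [Ring R] [Algebra ℂ R] {ι : Type*} [Fintype ι]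
    [DecidableEq ι] {S : Submodule ℂ R} {k : ℕ} (hS : S ^ k = ⊥) :
    (S.matrix : Submodule ℂ (Matrix ι ι R)) ^ k = ⊥ := by
  have h (m : ℕ) : (S.matrix : Submodule ℂ (Matrix ι ι R)) ^ m ≤ (S ^ m).matrix := by
    induction m with
    | zero =>
      rw [pow_zero, pow_zero, Submodule.one_le]
      intro i j
      rw [Matrix.one_apply]
      split_ifs
      · exact Submodule.one_le.mp le_rfl
      · exact Submodule.zero_mem _
    | succ m ih =>
      rw [pow_succ, pow_succ]
      exact (mul_le_mul_left ih _).trans (matrix_mul_matrix_le _ _)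
  refine (Submodule.eq_bot_iff _).mpr fun M hM => ?_
  ext i j
  simpa [hS] using h k hM i j

variable {V : Type*} [AddCommGroup V] [Module ℂ V] {n : ℕ}

/-- The square matrices over the exterior algebra whose entries have parity `s`. -/
noncomputable abbrev parityMatrix (V : Type*) [AddCommGroup V] [Module ℂ V] (n : ℕ) (s : ZMod 2) :
    Submodule ℂ (Matrix (Fin n) (Fin n) (ExteriorAlgebra ℂ V)) :=
  (evenOdd (0 : QuadraticForm ℂ V) s).matrix

/-- The square matrices over the exterior algebra whose trace is even. -/
noncomputable abbrev evenTrace (V : Type*) [AddCommGroup V] [Module ℂ V] (n : ℕ) :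
    Submodule ℂ (Matrix (Fin n) (Fin n) (ExteriorAlgebra ℂ V)) :=
  (evenOdd (0 : QuadraticForm ℂ V) 0).comap (Matrix.traceLinearMap (Fin n) ℂ _)

theorem one_mem_parityMatrix : 1 ∈ parityMatrix V n 0 := by
  intro i j
  rw [Matrix.one_apply]
  split_ifs
  · exact SetLike.one_mem_graded (evenOdd (0 : QuadraticForm ℂ V))
  · exact Submodule.zero_mem _

theorem mul_mem_parityMatrix {s t : ZMod 2}
    {M N : Matrix (Fin n) (Fin n) (ExteriorAlgebra ℂ V)}
    (hM : M ∈ parityMatrix V n s) (hN : N ∈ parityMatrix V n t) :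
    M * N ∈ parityMatrix V n (s + t) :=
  fun i j => evenOdd_mul_le _ s t
    (matrix_mul_matrix_le _ _ (Submodule.mul_mem_mul hM hN) i j)

theorem pow_mem_parityMatrix {s : ZMod 2} {M : Matrix (Fin n) (Fin n) (ExteriorAlgebra ℂ V)}
    (hM : M ∈ parityMatrix V n s) (k : ℕ) : M ^ k ∈ parityMatrix V n (k • s) := by
  induction k with
  | zero => rw [pow_zero, zero_smul]; exact one_mem_parityMatrix
  | succ k ih => rw [pow_succ, succ_nsmul]; exact mul_mem_parityMatrix ih hM

theorem trace_mem_evenOdd {s : ZMod 2} {M : Matrix (Fin n) (Fin n) (ExteriorAlgebra ℂ V)}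
    (hM : M ∈ parityMatrix V n s) : M.trace ∈ evenOdd (0 : QuadraticForm ℂ V) s :=
  Submodule.sum_mem _ fun i _ => hM i i

theorem commutator_mem_evenTrace (M N : Matrix (Fin n) (Fin n) (ExteriorAlgebra ℂ V)) :
    M * N - N * M ∈ evenTrace V n := by
  rw [Submodule.mem_comap, Matrix.traceLinearMap_apply, Matrix.trace_sub]
  simp only [Matrix.trace, Matrix.diag, Matrix.mul_apply]
  rw [Finset.sum_comm (f := fun i j => N i j * M j i), ← Finset.sum_sub_distrib]
  refine Submodule.sum_mem _ fun i _ => ?_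
  rw [← Finset.sum_sub_distrib]
  exact Submodule.sum_mem _ fun j _ => commutator_mem_evenOdd_zero _ _

theorem eq_zero_of_mem_evenOdd {x : ExteriorAlgebra ℂ V}
    (h₀ : x ∈ evenOdd (0 : QuadraticForm ℂ V) 0) (h₁ : x ∈ evenOdd (0 : QuadraticForm ℂ V) 1) :
    x = 0 :=
  Submodule.disjoint_def.mp (evenOdd_isCompl (0 : QuadraticForm ℂ V)).disjoint x h₀ h₁

theorem inverse_mem_parityMatrix {A Ai : Matrix (Fin n) (Fin n) (ExteriorAlgebra ℂ V)}
    (hA : A ∈ parityMatrix V n 0) (hAAi : A * Ai = 1) (hAiA : Ai * A = 1) :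
    Ai ∈ parityMatrix V n 0 := by
  have h (i j) : ∃ e ∈ evenOdd (0 : QuadraticForm ℂ V) 0,
      ∃ o ∈ evenOdd (0 : QuadraticForm ℂ V) 1, e + o = Ai i j :=
    Submodule.mem_sup.mp ((evenOdd_isCompl (0 : QuadraticForm ℂ V)).sup_eq_top ▸
      Submodule.mem_top)
  choose E hE O hO hEO using h
  have hsum : Ai = Matrix.of E + Matrix.of O := by
    ext i j
    exact (hEO i j).symm
  have hAO : A * Matrix.of O = 1 - A * Matrix.of E := by
    rw [← hAAi, hsum, mul_add, add_sub_cancel_left]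
  have hAO_zero : A * Matrix.of O = 0 := by
    ext i j
    refine eq_zero_of_mem_evenOdd ?_ (mul_mem_parityMatrix (s := 0) (t := 1) hA hO i j)
    rw [hAO]
    exact sub_mem (one_mem_parityMatrix (V := V))
      (mul_mem_parityMatrix (s := 0) (t := 0) hA hE) i j
  have hO_zero : Matrix.of O = 0 := by
    rw [← one_mul (Matrix.of O), ← hAiA, mul_assoc, hAO_zero, mul_zero]
  rw [hsum, hO_zero, add_zero]
  exact hE

theorem queerDetExponent_mem_evenOdd_one (d : ℕ)
    {M : Matrix (Fin n) (Fin n) (ExteriorAlgebra ℂ V)} (hM : M ∈ parityMatrix V n 1) :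
    queerDetExponent d M ∈ evenOdd (0 : QuadraticForm ℂ V) 1 := by
  refine Submodule.sum_mem _ fun i _ => Submodule.smul_mem _ _ (trace_mem_evenOdd ?_)
  have h := pow_mem_parityMatrix hM (2 * i + 1)
  rwa [nsmul_one, ZMod.natCast_eq_one_iff_odd.mpr (odd_two_mul_add_one i)] at h

theorem trace_truncLog_sub_queerDetExponent_mem (d : ℕ)
    {M : Matrix (Fin n) (Fin n) (ExteriorAlgebra ℂ V)} (hM : M ∈ parityMatrix V n 1) :
    (truncLog (2 * d) M).trace - queerDetExponent d M
      ∈ evenOdd (0 : QuadraticForm ℂ V) 0 := by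
  induction d with
  | zero => simp [truncLog, queerDetExponent]
  | succ d ih =>
    have heven : M ^ (2 * d + 1 + 1) ∈ parityMatrix V n 0 := by
      have h := pow_mem_parityMatrix hM (2 * (d + 1))
      rwa [nsmul_one, (ZMod.natCast_eq_zero_iff _ _).mpr (dvd_mul_right 2 (d + 1))] at h
    have h := add_mem ih (Submodule.smul_mem _
      ((((2 * d + 1 + 1 : ℕ) : ℂ))⁻¹ * (-1) ^ (2 * d + 1)) (trace_mem_evenOdd heven))
    convert h using 1
    rw [truncLog, show 2 * (d + 1) = 2 * d + 1 + 1 by ring, Finset.sum_range_succ,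
      Finset.sum_range_succ, Matrix.trace_add, Matrix.trace_add, Matrix.trace_smul,
      Matrix.trace_smul, queerDetExponent, Finset.sum_range_succ, truncLog, queerDetExponent,
      (even_two_mul d).neg_one_pow, mul_one]
    abel

theorem trace_truncLog_mem_evenOdd_zero (m : ℕ)
    {M : Matrix (Fin n) (Fin n) (ExteriorAlgebra ℂ V)} (hM : M ∈ parityMatrix V n 0) :
    (truncLog m M).trace ∈ evenOdd (0 : QuadraticForm ℂ V) 0 := by
  refine trace_mem_evenOdd (Submodule.sum_mem _ fun k _ => Submodule.smul_mem _ _ ?_)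
  simpa using pow_mem_parityMatrix hM (k + 1)

theorem pow_eq_zero_of_entries_mem_exteriorPosPart [FiniteDimensional ℂ V]
    {M : Matrix (Fin n) (Fin n) (ExteriorAlgebra ℂ V)} (hM : M ∈ (exteriorPosPart V).matrix)
    {k : ℕ} (hk : Module.finrank ℂ V < k) : M ^ k = 0 := by
  have h := Submodule.pow_mem_pow _ hM k
  rwa [matrix_pow_eq_bot (exteriorPosPart_pow_eq_bot hk), Submodule.mem_bot] at h

theorem parityMatrix_one_le : parityMatrix V n 1 ≤ (exteriorPosPart V).matrix :=
  fun _ hM i j => evenOdd_one_le_exteriorPosPart (hM i j)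

theorem queerDetExponent_finrank_succ [FiniteDimensional ℂ V]
    {M : Matrix (Fin n) (Fin n) (ExteriorAlgebra ℂ V)} (hM : M ∈ parityMatrix V n 1) :
    queerDetExponent (Module.finrank ℂ V + 1) M = queerDetExponent (Module.finrank ℂ V) M := by
  rw [queerDetExponent, Finset.sum_range_succ, pow_eq_zero_of_entries_mem_exteriorPosPart
    (parityMatrix_one_le hM) (by omega), Matrix.trace_zero, smul_zero, add_zero, queerDetExponent]

theorem queerDetExponent_conj (d : ℕ) {A Ai M : Matrix (Fin n) (Fin n) (ExteriorAlgebra ℂ V)}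
    (hA : A ∈ parityMatrix V n 0) (hAi : Ai ∈ parityMatrix V n 0) (hAAi : A * Ai = 1)
    (hM : M ∈ parityMatrix V n 1) :
    queerDetExponent d (Ai * M * A) = queerDetExponent d M := by
  have hconj : Ai * M * A ∈ parityMatrix V n 1 :=
    mul_mem_parityMatrix (s := 1) (t := 0) (mul_mem_parityMatrix (s := 0) (t := 1) hAi hM) hA
  refine sub_eq_zero.mp (eq_zero_of_mem_evenOdd ?_ (sub_mem
    (queerDetExponent_mem_evenOdd_one d hconj) (queerDetExponent_mem_evenOdd_one d hM)))
  have h := truncLog_conj_sub_mem commutator_mem_evenTrace (2 * d) hAAi M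
  rw [Submodule.mem_comap, Matrix.traceLinearMap_apply, Matrix.trace_sub] at h
  convert add_mem (sub_mem h (trace_truncLog_sub_queerDetExponent_mem d hconj))
    (trace_truncLog_sub_queerDetExponent_mem d hM) using 1
  abel

theorem queerDetExponent_unipotent_mul [FiniteDimensional ℂ V]
    {X Y Z : Matrix (Fin n) (Fin n) (ExteriorAlgebra ℂ V)}
    (hX : X ∈ parityMatrix V n 1) (hY : Y ∈ parityMatrix V n 1) (hZ : Z ∈ parityMatrix V n 1)
    (h : (1 + X * Y) * Z = X + Y) :
    queerDetExponent (Module.finrank ℂ V) Z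
      = queerDetExponent (Module.finrank ℂ V) X + queerDetExponent (Module.finrank ℂ V) Y := by
  rw [← queerDetExponent_finrank_succ hX, ← queerDetExponent_finrank_succ hY,
    ← queerDetExponent_finrank_succ hZ]
  set d := Module.finrank ℂ V + 1 with hd
  have hS : ((exteriorPosPart V).matrix : Submodule ℂ (Matrix (Fin n) (Fin n) _))
      * (exteriorPosPart V).matrix ≤ (exteriorPosPart V).matrix :=
    (matrix_mul_matrix_le _ _).trans fun _ hM i j => exteriorPosPart_mul_self_le (hM i j)
  have hm : ((exteriorPosPart V).matrix : Submodule ℂ (Matrix (Fin n) (Fin n) _)) ^ (2 * d) = ⊥ :=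
    matrix_pow_eq_bot (exteriorPosPart_pow_eq_bot (by omega))
  have hXp := parityMatrix_one_le hX
  have hYp := parityMatrix_one_le hY
  have h₁ := truncLog_mul_mem commutator_mem_evenTrace hS hm hXp hYp
  have h₂ := truncLog_mul_mem commutator_mem_evenTrace hS hm
    (hS (Submodule.mul_mem_mul hXp hYp)) (parityMatrix_one_le hZ)
  have heq : X * Y + Z + X * Y * Z = X + Y + X * Y := by
    rw [← h]
    noncomm_ring
  rw [heq] at h₂
  rw [Submodule.mem_comap, Matrix.traceLinearMap_apply, Matrix.trace_sub, Matrix.trace_add]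
    at h₁ h₂
  have hXY := trace_truncLog_mem_evenOdd_zero (2 * d)
    (mul_mem_parityMatrix (s := 1) (t := 1) hX hY)
  refine sub_eq_zero.mp (eq_zero_of_mem_evenOdd ?_ (sub_mem
    (queerDetExponent_mem_evenOdd_one d hZ)
    (add_mem (queerDetExponent_mem_evenOdd_one d hX) (queerDetExponent_mem_evenOdd_one d hY))))
  convert sub_mem (add_mem (sub_mem (sub_mem h₁ h₂) hXY)
    (add_mem (trace_truncLog_sub_queerDetExponent_mem d hX)
      (trace_truncLog_sub_queerDetExponent_mem d hY)))
    (trace_truncLog_sub_queerDetExponent_mem d hZ) using 1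
  abel

end MatrixParity

/-- Multiplicativity of the queer determinant
`qet(A,B) := 1 + τ·Σ tr((A⁻¹B)^{2i−1})/(2i−1)` on `GQ(n; Λ(V))`, where
`Λ(V)` is the exterior algebra of a `d`-dimensional complex vector space:
for `(A, B), (A', B')` in `GQ(n; Λ)` (so `A, A'` invertible with even entries
and `B, B'` with odd entries), the product `A·A' + B·B'` is invertible with
even entries, `A·B' + B·A'` has odd entries, and
`q(A·A' + B·B', A·B' + B·A') = q(A, B) + q(A', B')`; equivalently, since
`τ² = 0`, `qet` is a group homomorphism `GQ(n; Λ) → GL(1; Λ[τ])`. -/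
theorem queerDet_hom {V : Type*} [AddCommGroup V] [Module ℂ V]
    [FiniteDimensional ℂ V] {n : ℕ} (hn : 1 ≤ n)
    (A Ai A' Ai' B B' : Matrix (Fin n) (Fin n) (ExteriorAlgebra ℂ V))
    (hA : ∀ i j, A i j ∈ exteriorEvenPart V)
    (hA' : ∀ i j, A' i j ∈ exteriorEvenPart V)
    (hB : ∀ i j, B i j ∈ exteriorOddPart V)
    (hB' : ∀ i j, B' i j ∈ exteriorOddPart V)
    (hAAi : A * Ai = 1) (hAiA : Ai * A = 1)
    (hAAi' : A' * Ai' = 1) (hAiA' : Ai' * A' = 1) :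
    (∀ i j, (A * A' + B * B') i j ∈ exteriorEvenPart V) ∧
    (∀ i j, (A * B' + B * A') i j ∈ exteriorOddPart V) ∧
    (∃ E : Matrix (Fin n) (Fin n) (ExteriorAlgebra ℂ V),
      (A * A' + B * B') * E = 1 ∧ E * (A * A' + B * B') = 1) ∧
    (∀ E : Matrix (Fin n) (Fin n) (ExteriorAlgebra ℂ V),
      (A * A' + B * B') * E = 1 → E * (A * A' + B * B') = 1 →
      queerDetExponent (Module.finrank ℂ V) (E * (A * B' + B * A'))
        = queerDetExponent (Module.finrank ℂ V) (Ai * B)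
          + queerDetExponent (Module.finrank ℂ V) (Ai' * B')) := by
  change A ∈ (exteriorEvenPart V).matrix at hA
  change A' ∈ (exteriorEvenPart V).matrix at hA'
  change B ∈ (exteriorOddPart V).matrix at hB
  change B' ∈ (exteriorOddPart V).matrix at hB'
  change A * A' + B * B' ∈ (exteriorEvenPart V).matrix ∧
    A * B' + B * A' ∈ (exteriorOddPart V).matrix ∧ _
  rw [exteriorEvenPart_eq_evenOdd] at *
  rw [exteriorOddPart_eq_evenOdd] at *
  have heven : A * A' + B * B' ∈ parityMatrix V n 0 :=
    add_mem (mul_mem_parityMatrix (s := 0) (t := 0) hA hA')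
      (mul_mem_parityMatrix (s := 1) (t := 1) hB hB')
  have hodd : A * B' + B * A' ∈ parityMatrix V n 1 :=
    add_mem (mul_mem_parityMatrix (s := 0) (t := 1) hA hB')
      (mul_mem_parityMatrix (s := 1) (t := 0) hB hA')
  have hAi := inverse_mem_parityMatrix hA hAAi hAiA
  have hAi' := inverse_mem_parityMatrix hA' hAAi' hAiA'
  have hM : Ai * B ∈ parityMatrix V n 1 := mul_mem_parityMatrix (s := 0) (t := 1) hAi hB
  have hY : Ai' * B' ∈ parityMatrix V n 1 := mul_mem_parityMatrix (s := 0) (t := 1) hAi' hB'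
  have hX : Ai' * (Ai * B) * A' ∈ parityMatrix V n 1 :=
    mul_mem_parityMatrix (s := 1) (t := 0) (mul_mem_parityMatrix (s := 0) (t := 1) hAi' hM) hA'
  set X := Ai' * (Ai * B) * A' with hXdef
  set Y := Ai' * B' with hYdef
  have hAX : A * A' * X = B * A' := by
    rw [hXdef]
    simp only [← mul_assoc]
    rw [mul_assoc A A' Ai', hAAi', mul_one, hAAi, one_mul]
  have hAY : A * A' * Y = A * B' := by
    rw [hYdef, ← mul_assoc, mul_assoc A A' Ai', hAAi', mul_one]
  have hYB : A' * Y = B' := by rw [hYdef, ← mul_assoc, hAAi', one_mul]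
  have hfactor : A * A' + B * B' = A * A' * (1 + X * Y) := by
    rw [mul_add, mul_one, ← mul_assoc, hAX, mul_assoc B, hYB]
  have hfactor_odd : A * B' + B * A' = A * A' * (X + Y) := by
    rw [mul_add, hAX, hAY, add_comm]
  have hinv : Ai' * Ai * (A * A') = 1 := by
    rw [mul_assoc, ← mul_assoc Ai, hAiA, one_mul, hAiA']
  refine ⟨heven, hodd, ?_, fun E hE₁ hE₂ => ?_⟩
  · have hXY : X * Y ∈ (exteriorPosPart V).matrix := fun i j =>
      exteriorPosPart_mul_self_le (matrix_mul_matrix_le _ _ (Submodule.mul_mem_mul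
        (parityMatrix_one_le hX) (parityMatrix_one_le hY)) i j)
    have hunit : IsUnit (A * A' + B * B') := by
      rw [hfactor]
      refine ((isUnit_iff_exists.mpr ⟨Ai, hAAi, hAiA⟩).mul
        (isUnit_iff_exists.mpr ⟨Ai', hAAi', hAiA'⟩)).mul (IsNilpotent.isUnit_one_add
        ⟨_, pow_eq_zero_of_entries_mem_exteriorPosPart hXY (Nat.lt_succ_self _)⟩)
    obtain ⟨u, hu⟩ := hunit
    exact ⟨↑u⁻¹, by rw [← hu, Units.mul_inv], by rw [← hu, Units.inv_mul]⟩
  · have hE := inverse_mem_parityMatrix heven hE₁ hE₂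
    have hZ : E * (A * B' + B * A') ∈ parityMatrix V n 1 :=
      mul_mem_parityMatrix (s := 0) (t := 1) hE hodd
    have hrel : (1 + X * Y) * (E * (A * B' + B * A')) = X + Y := by
      have h : A * A' * ((1 + X * Y) * (E * (A * B' + B * A'))) = A * A' * (X + Y) := by
        rw [← mul_assoc, ← hfactor, ← mul_assoc, hE₁, one_mul, hfactor_odd]
      have h' := congrArg (Ai' * Ai * ·) h
      simpa only [← mul_assoc (Ai' * Ai) (A * A'), hinv, one_mul] using h'
    rw [queerDetExponent_unipotent_mul hX hY hZ hrel, hXdef,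
      queerDetExponent_conj _ hA' hAi' hAAi' hM]
end

section
/- Let K be a field, V a finite-dimensional K-vector space, and φ : Λ(V) → Λ(V) a K-algebra endomorphism of the exterior algebra preserving parity (φ(Λ₀) ⊆ Λ₀ and φ(Λ₁) ⊆ Λ₁). Let ℓ : V → V be the linear map obtained by composing the inclusion V ↪ Λ(V), the map φ, and the projection of Λ(V) onto its exterior-degree-one component ⋀¹V ≅ V. Then φ is bijective (an automorphism of Λ(V)) if and only if ℓ is bijective. -/
/-- The part of parity `ε` of the exterior algebra `Λ(V)`: the sum of the
exterior powers of degree congruent to `ε` mod `2`. -/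
noncomputable def exteriorParityPart (K : Type*) [Field K]
    (V : Type*) [AddCommGroup V] [Module K V] (ε : ZMod 2) :
    Submodule K (ExteriorAlgebra K V) :=
  ⨆ k : {k : ℕ // (k : ZMod 2) = ε}, ⋀[K]^(k : ℕ) V

namespace ExteriorAlgebra

section CommRing

variable {R M : Type*} [CommRing R] [AddCommGroup M] [Module R M]

theorem algebraMapInv_ι (m : M) : algebraMapInv (ι R m) = 0 := by
  simp [algebraMapInv]

theorem ιInv_mul (x y : ExteriorAlgebra R M) :
    ιInv (x * y) = algebraMapInv x • ιInv y + algebraMapInv y • ιInv x := by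
  let : Module Rᵐᵒᵖ M := Module.compHom _ ((RingHom.id R).fromOpposite mul_comm)
  have : IsCentralScalar R M := ⟨fun r m => rfl⟩
  have hfst : (TrivSqZeroExt.fstHom R R M).comp toTrivSqZeroExt = algebraMapInv := by
    ext m
    simp [algebraMapInv_ι]
  have hfst' (z : ExteriorAlgebra R M) : (toTrivSqZeroExt z).fst = algebraMapInv z :=
    DFunLike.congr_fun hfst z
  change (toTrivSqZeroExt (x * y)).snd =
    algebraMapInv x • (toTrivSqZeroExt y).snd + algebraMapInv y • (toTrivSqZeroExt x).snd
  rw [map_mul, TrivSqZeroExt.snd_mul, hfst', hfst', op_smul_eq_smul]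

theorem ιInv_algebraMap (r : R) : ιInv (algebraMap R (ExteriorAlgebra R M) r) = 0 := by
  have h := ιInv_mul (1 : ExteriorAlgebra R M) 1
  simp only [mul_one, map_one, one_smul] at h
  rw [Algebra.algebraMap_eq_smul_one, map_smul, left_eq_add.mp h, smul_zero]

theorem algebraMapInv_eq_zero_of_mem_exteriorPower {k : ℕ} (hk : k ≠ 0)
    {x : ExteriorAlgebra R M} (hx : x ∈ ⋀[R]^k M) : algebraMapInv x = 0 := by
  obtain ⟨k, rfl⟩ := Nat.exists_eq_succ_of_ne_zero hk
  suffices h : ⋀[R]^(k + 1) M ≤ LinearMap.ker (algebraMapInv (R := R) (M := M)).toLinearMap from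
    h hx
  rw [exteriorPower, pow_succ', Submodule.mul_le]
  rintro _ ⟨m, rfl⟩ y -
  simp [algebraMapInv_ι]

theorem ιInv_eq_zero_of_mem_exteriorPower {k : ℕ} (hk : 2 ≤ k)
    {x : ExteriorAlgebra R M} (hx : x ∈ ⋀[R]^k M) : ιInv x = 0 := by
  obtain ⟨k, rfl⟩ := Nat.exists_eq_add_of_le' hk
  suffices h : ⋀[R]^(k + 2) M ≤ LinearMap.ker (ιInv (R := R) (M := M)) from h hx
  rw [exteriorPower, pow_succ', Submodule.mul_le]
  rintro _ ⟨m, rfl⟩ y hy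
  rw [LinearMap.mem_ker, ιInv_mul, algebraMapInv_ι,
    algebraMapInv_eq_zero_of_mem_exteriorPower k.succ_ne_zero hy, zero_smul, zero_smul, add_zero]

theorem ιInv_comp_algHom_apply (φ : ExteriorAlgebra R M →ₐ[R] ExteriorAlgebra R M)
    (hφ : ∀ m, algebraMapInv (φ (ι R m)) = 0) (x : ExteriorAlgebra R M) :
    ιInv (φ x) = (ιInv ∘ₗ φ.toLinearMap ∘ₗ ι R) (ιInv x) := by
  have haug : algebraMapInv.comp φ = algebraMapInv := by
    ext m
    simp [hφ, algebraMapInv_ι]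
  have haug' (z : ExteriorAlgebra R M) : algebraMapInv (φ z) = algebraMapInv z :=
    DFunLike.congr_fun haug z
  induction x using ExteriorAlgebra.induction with
  | algebraMap r => simp only [AlgHom.commutes, ιInv_algebraMap, map_zero]
  | ι m => rw [ι_leftInverse m]; rfl
  | mul a b ha hb => simp only [map_mul, ιInv_mul, haug', ha, hb, map_add, map_smul]
  | add a b ha hb => simp only [map_add, ha, hb]

variable (R M) in
/-- The part of the exterior algebra of degree at least `k`. -/
def degreeGE (k : ℕ) : Submodule R (ExteriorAlgebra R M) :=
  ⨆ j : {j : ℕ // k ≤ j}, ⋀[R]^(j : ℕ) M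

theorem exteriorPower_le_degreeGE {k j : ℕ} (h : k ≤ j) : ⋀[R]^j M ≤ degreeGE R M k :=
  le_iSup (fun j : {j : ℕ // k ≤ j} => ⋀[R]^(j : ℕ) M) ⟨j, h⟩

theorem degreeGE_zero : degreeGE R M 0 = ⊤ := by
  rw [eq_top_iff,
    ← (DirectSum.Decomposition.isInternal fun i : ℕ => ⋀[R]^i M).submodule_iSup_eq_top]
  exact iSup_le fun j => exteriorPower_le_degreeGE j.zero_le

theorem degreeGE_le_sup (k : ℕ) : degreeGE R M k ≤ ⋀[R]^k M ⊔ degreeGE R M (k + 1) := by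
  refine iSup_le fun ⟨j, hj⟩ => ?_
  rcases hj.eq_or_lt with rfl | hj
  · exact le_sup_left
  · exact (exteriorPower_le_degreeGE hj).trans le_sup_right

theorem degreeGE_mul_le (a b : ℕ) :
    degreeGE R M a * degreeGE R M b ≤ degreeGE R M (a + b) := by
  rw [degreeGE, degreeGE, Submodule.iSup_mul]
  refine iSup_le fun i => ?_
  rw [Submodule.mul_iSup]
  refine iSup_le fun j => ?_
  rw [exteriorPower, exteriorPower, ← pow_add]
  exact exteriorPower_le_degreeGE (add_le_add i.2 j.2)

theorem sub_ι_ιInv_mem_degreeGE_two {x : ExteriorAlgebra R M} (hx : algebraMapInv x = 0) :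
    x - ι R (ιInv x) ∈ degreeGE R M 2 := by
  have h0 : x ∈ ⋀[R]^0 M ⊔ degreeGE R M 1 :=
    degreeGE_le_sup 0 (by rw [degreeGE_zero]; trivial)
  obtain ⟨a, ha, y, hy, rfl⟩ := Submodule.mem_sup.mp h0
  obtain ⟨b, hb, c, hc, rfl⟩ := Submodule.mem_sup.mp (degreeGE_le_sup 1 hy)
  rw [exteriorPower, pow_zero] at ha
  obtain ⟨r, rfl⟩ := Submodule.mem_one.mp ha
  rw [exteriorPower, pow_one] at hb
  obtain ⟨m, rfl⟩ := hb
  have hc0 : degreeGE R M 2 ≤ LinearMap.ker (algebraMapInv (R := R) (M := M)).toLinearMap :=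
    iSup_le fun j _ h => algebraMapInv_eq_zero_of_mem_exteriorPower (by have := j.2; omega) h
  have hc1 : degreeGE R M 2 ≤ LinearMap.ker (ιInv (R := R) (M := M)) :=
    iSup_le fun j _ h => ιInv_eq_zero_of_mem_exteriorPower j.2 h
  have hc0' : algebraMapInv c = 0 := hc0 hc
  have hc1' : ιInv c = 0 := hc1 hc
  have hr : r = 0 := by
    simpa [hc0', algebraMapInv_ι] using hx
  subst hr
  simpa [hc1', ι_leftInverse m] using hc

theorem exteriorPower_le_range_sup_degreeGE
    {φ : ExteriorAlgebra R M →ₐ[R] ExteriorAlgebra R M}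
    (hφ : ∀ m, algebraMapInv (φ (ι R m)) = 0)
    (hℓ : Function.Surjective (ιInv ∘ₗ φ.toLinearMap ∘ₗ ι R)) (k : ℕ) :
    ⋀[R]^k M ≤ LinearMap.range φ.toLinearMap ⊓ degreeGE R M k ⊔ degreeGE R M (k + 1) := by
  have h1 : LinearMap.range (ι R (M := M)) ≤
      LinearMap.range φ.toLinearMap ⊓ degreeGE R M 1 ⊔ degreeGE R M 2 := by
    rintro _ ⟨w, rfl⟩
    obtain ⟨v, rfl⟩ := hℓ w
    have hd := sub_ι_ιInv_mem_degreeGE_two (hφ v)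
    have h12 : degreeGE R M 2 ≤ degreeGE R M 1 :=
      iSup_le fun j => exteriorPower_le_degreeGE (one_le_two.trans j.2)
    have hι : ι R (ιInv (φ (ι R v))) ∈ degreeGE R M 1 :=
      exteriorPower_le_degreeGE le_rfl (by rw [exteriorPower, pow_one]; exact ⟨_, rfl⟩)
    refine Submodule.mem_sup.mpr ⟨φ (ι R v), ⟨⟨_, rfl⟩, ?_⟩, _, neg_mem hd, ?_⟩
    · simpa using add_mem (h12 hd) hι
    · simp
  induction k with
  | zero =>
    refine le_trans ?_ le_sup_left
    refine le_inf ?_ (exteriorPower_le_degreeGE le_rfl)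
    rw [exteriorPower, pow_zero, Submodule.one_le]
    exact ⟨1, map_one φ⟩
  | succ k ih =>
    rw [exteriorPower, pow_succ]
    refine (mul_le_mul' ih h1).trans ?_
    rw [Submodule.sup_mul, Submodule.mul_sup]
    refine sup_le (sup_le ?_ ?_) ?_
    · refine le_sup_of_le_left (le_inf ?_ ?_)
      · rw [Submodule.mul_le]
        rintro _ ⟨⟨a, rfl⟩, -⟩ _ ⟨⟨b, rfl⟩, -⟩
        exact ⟨a * b, map_mul φ a b⟩
      · exact (mul_le_mul' inf_le_right inf_le_right).trans (degreeGE_mul_le k 1)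
    · exact le_sup_of_le_right
        ((mul_le_mul' inf_le_right le_rfl).trans (degreeGE_mul_le k 2))
    · have h12 : degreeGE R M 2 ≤ degreeGE R M 1 :=
        iSup_le fun j => exteriorPower_le_degreeGE (one_le_two.trans j.2)
      exact le_sup_of_le_right
        ((mul_le_mul' le_rfl (sup_le inf_le_right h12)).trans
          (degreeGE_mul_le (k + 1) 1))

end CommRing

section Field

variable {K V : Type*} [Field K] [AddCommGroup V] [Module K V] [FiniteDimensional K V]

theorem exteriorPower_eq_bot_of_finrank_lt {k : ℕ} (hk : Module.finrank K V < k) :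
    ⋀[K]^k V = ⊥ := by
  rw [← ιMulti_span_fixedDegree, Submodule.span_eq_bot]
  rintro _ ⟨v, rfl⟩
  refine AlternatingMap.map_linearDependent _ v fun h => ?_
  have := h.fintype_card_le_finrank
  rw [Fintype.card_fin] at this
  omega

theorem surjective_of_surjective_ιInv_comp
    {φ : ExteriorAlgebra K V →ₐ[K] ExteriorAlgebra K V}
    (hφ : ∀ v, algebraMapInv (φ (ι K v)) = 0)
    (hℓ : Function.Surjective (ιInv ∘ₗ φ.toLinearMap ∘ₗ ι K)) :
    Function.Surjective φ := by
  have hstep (k : ℕ) (hk : degreeGE K V (k + 1) ≤ LinearMap.range φ.toLinearMap) :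
      degreeGE K V k ≤ LinearMap.range φ.toLinearMap :=
    (degreeGE_le_sup k).trans <| sup_le
      ((exteriorPower_le_range_sup_degreeGE hφ hℓ k).trans (sup_le inf_le_left hk)) hk
  have htop : degreeGE K V (Module.finrank K V + 1) ≤ LinearMap.range φ.toLinearMap :=
    iSup_le fun j => (exteriorPower_eq_bot_of_finrank_lt j.2).trans_le bot_le
  have hzero : degreeGE K V 0 ≤ LinearMap.range φ.toLinearMap :=
    Nat.decreasingInduction (motive := fun k _ => degreeGE K V k ≤ LinearMap.range φ.toLinearMap)
      (fun k _ => hstep k) htop (Nat.zero_le _)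
  rw [degreeGE_zero, top_le_iff] at hzero
  exact LinearMap.range_eq_top.mp hzero

end Field

end ExteriorAlgebra

theorem algebraMapInv_eq_zero_of_mem_exteriorParityPart_one {K V : Type*} [Field K]
    [AddCommGroup V] [Module K V] {x : ExteriorAlgebra K V}
    (hx : x ∈ exteriorParityPart K V 1) : ExteriorAlgebra.algebraMapInv x = 0 := by
  have h : exteriorParityPart K V 1 ≤
      LinearMap.ker (ExteriorAlgebra.algebraMapInv (R := K) (M := V)).toLinearMap := by
    refine iSup_le fun ⟨k, hk⟩ _ hy =>
      ExteriorAlgebra.algebraMapInv_eq_zero_of_mem_exteriorPower ?_ hy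
    rintro rfl
    exact absurd hk (by decide)
  exact h hx

theorem ι_mem_exteriorParityPart_one {K V : Type*} [Field K]
    [AddCommGroup V] [Module K V] (v : V) :
    ExteriorAlgebra.ι K v ∈ exteriorParityPart K V 1 := by
  refine Submodule.mem_iSup_of_mem ⟨1, Nat.cast_one⟩ ?_
  rw [ExteriorAlgebra.exteriorPower, pow_one]
  exact ⟨v, rfl⟩

/-- A parity-preserving algebra endomorphism `φ` of the exterior algebra
`Λ(V)` of a finite-dimensional vector space `V` is an automorphism if and only
if its linear part `ℓ : V → V` (the composition of `V ↪ Λ(V)`, `φ`, and the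
projection onto the degree-one component) is bijective. -/
theorem exterior_endo_bijective_iff_linear_part_bijective
    {K : Type*} [Field K] {V : Type*} [AddCommGroup V] [Module K V]
    [FiniteDimensional K V]
    (φ : ExteriorAlgebra K V →ₐ[K] ExteriorAlgebra K V)
    (hpar : ∀ ε : ZMod 2, ∀ x ∈ exteriorParityPart K V ε,
      φ x ∈ exteriorParityPart K V ε) :
    Function.Bijective φ ↔
      Function.Bijective
        (ExteriorAlgebra.ιInv ∘ₗ φ.toLinearMap ∘ₗ ExteriorAlgebra.ι K (M := V)) := by
  have hφ (v : V) : ExteriorAlgebra.algebraMapInv (φ (ExteriorAlgebra.ι K v)) = 0 :=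
    algebraMapInv_eq_zero_of_mem_exteriorParityPart_one
      (hpar 1 _ (ι_mem_exteriorParityPart_one v))
  constructor
  · intro h
    have hsurj : Function.Surjective
        (ExteriorAlgebra.ιInv ∘ₗ φ.toLinearMap ∘ₗ ExteriorAlgebra.ι K (M := V)) := by
      intro w
      obtain ⟨x, hx⟩ := h.2 (ExteriorAlgebra.ι K w)
      refine ⟨ExteriorAlgebra.ιInv x, ?_⟩
      rw [← ExteriorAlgebra.ιInv_comp_algHom_apply φ hφ, hx, ExteriorAlgebra.ι_leftInverse w]
    exact ⟨LinearMap.injective_iff_surjective.mpr hsurj, hsurj⟩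
  · intro h
    have hsurj := ExteriorAlgebra.surjective_of_surjective_ιInv_comp hφ h.2
    have : FiniteDimensional K (ExteriorAlgebra K V) :=
      Module.Finite.of_basis (Module.finBasis K V).ExteriorAlgebra
    exact ⟨(LinearMap.injective_iff_surjective (f := φ.toLinearMap)).mpr hsurj, hsurj⟩
end
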